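/- Let k ≥ 1, let p ∈ ℝ², let q : ZMod k → ℝ² satisfy qⱼ ≠ p for all j, and let A : ZMod k → (ℝ² →ᵃ[ℝ] ℝ) be a cyclic family of affine maps such that for each j the affine map A_{j+1} − A_j vanishes at every point of the line through p and qⱼ. Then there exists a family of weights w : ZMod k → ℝ such that A_{j+1}(x) − A_j(x) = wⱼ · det(qⱼ − p, x − p) for all j and all x ∈ ℝ², and the equilibrium condition ∑ⱼ wⱼ • (qⱼ − p) = 0 holds in ℝ². -/

import Mathlib

/-- The 2×2 determinant of two vectors in `ℝ²`. -/
def det2 (u v : Fin 2 → ℝ) : ℝ := u 0 * v 1 - u 1 * v 0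

/-- A linear form on `ℝ²` that kills `u ≠ 0` is a multiple of `det2 u`. -/
theorem exists_eq_mul_det2 (L : (Fin 2 → ℝ) →ₗ[ℝ] ℝ) {u : Fin 2 → ℝ} (hu : u ≠ 0)
    (hL : L u = 0) : ∃ w : ℝ, ∀ v, L v = w * det2 u v := by
  have hcoord (v : Fin 2 → ℝ) : L v = v 0 * L (Pi.single 0 1) + v 1 * L (Pi.single 1 1) := by
    rw [L.pi_apply_eq_sum_univ v, Fin.sum_univ_two]
    congr <;> ext i <;> fin_cases i <;> simp
  have hnorm : u 0 ^ 2 + u 1 ^ 2 ≠ 0 := by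
    intro h
    refine hu (funext fun i => ?_)
    fin_cases i <;> simp only [Fin.zero_eta, Fin.mk_one, Pi.zero_apply] <;> nlinarith
  rw [hcoord] at hL
  refine ⟨(u 0 * L (Pi.single 1 1) - u 1 * L (Pi.single 0 1)) / (u 0 ^ 2 + u 1 ^ 2),
    fun v => ?_⟩
  rw [hcoord v, det2]
  field_simp
  linear_combination (u 0 * v 0 + u 1 * v 1) * hL

/-- An affine function on `ℝ²` vanishing at `p` and `p + u`, with `u ≠ 0`, is a multiple of
`x ↦ det2 u (x - p)`. -/
theorem AffineMap.exists_eq_mul_det2 (f : (Fin 2 → ℝ) →ᵃ[ℝ] ℝ) {p u : Fin 2 → ℝ}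
    (hu : u ≠ 0) (hp : f p = 0) (hpu : f (p + u) = 0) :
    ∃ w : ℝ, ∀ x, f x = w * det2 u (x - p) := by
  have hlin (v : Fin 2 → ℝ) : f.linear v = f (p + v) := by
    simpa [hp, add_comm] using (f.map_vadd p v).symm
  obtain ⟨w, hw⟩ := _root_.exists_eq_mul_det2 f.linear hu ((hlin u).trans hpu)
  refine ⟨w, fun x => ?_⟩
  rw [← hw, hlin, add_sub_cancel]

/-- Given `k ≥ 1`, a vertex `p`, neighbors `qⱼ ≠ p` indexed by
`ZMod k`, and a cyclic family of affine maps `Aⱼ` such that `A_{j+1} − A_j`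
vanishes on the line through `p` and `qⱼ`, there exist weights `wⱼ`
reconstructing the differences and satisfying the equilibrium condition
`∑ⱼ wⱼ • (qⱼ − p) = 0`. -/
theorem stmt_3 (k : ℕ) [NeZero k] (p : Fin 2 → ℝ) (q : ZMod k → (Fin 2 → ℝ))
    (hq : ∀ j, q j ≠ p)
    (A : ZMod k → ((Fin 2 → ℝ) →ᵃ[ℝ] ℝ))
    (hline : ∀ j : ZMod k, ∀ t : ℝ,
      A (j + 1) (p + t • (q j - p)) - A j (p + t • (q j - p)) = 0) :
    ∃ w : ZMod k → ℝ,
      (∀ (j : ZMod k) (x : Fin 2 → ℝ),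
        A (j + 1) x - A j x = w j * det2 (q j - p) (x - p)) ∧
      ∑ j : ZMod k, w j • (q j - p) = 0 := by
  have hdiff (j : ZMod k) : ∃ w : ℝ, ∀ x, A (j + 1) x - A j x = w * det2 (q j - p) (x - p) :=
    AffineMap.exists_eq_mul_det2 (A (j + 1) - A j) (sub_ne_zero.2 (hq j))
      (by simpa using hline j 0) (by simpa using hline j 1)
  choose w hw using hdiff
  refine ⟨w, hw, ?_⟩
  have hsum (v : Fin 2 → ℝ) : ∑ j, w j * det2 (q j - p) v = 0 := by
    have hcyc : ∑ j, A (j + 1) (p + v) = ∑ j, A j (p + v) :=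
      Equiv.sum_comp (Equiv.addRight (1 : ZMod k)) fun j => A j (p + v)
    calc ∑ j, w j * det2 (q j - p) v = ∑ j, (A (j + 1) (p + v) - A j (p + v)) := by
          simp only [hw, add_sub_cancel_left]
      _ = 0 := by rw [Finset.sum_sub_distrib, hcyc, sub_self]
  ext i
  fin_cases i
  · simpa [det2] using hsum ![0, 1]
  · simpa [det2] using hsum ![-1, 0]
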